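/- For every integer m ≥ 1 there exists a constant c = c(m) such that for every finite set S ⊆ ℕ^m of multi-indices, ∑_{α ∈ S} |α| ≥ E_m·(#S)^{1+1/m} − c·(#S), where |α| := α₁ + ⋯ + α_m and E_m := (m/(m+1))·(m!)^{1/m}. (This is the combinatorial degree count underlying the exponent E_m·μ^{1+1/m} in the interpolation determinant estimate: choosing μ distinct monomials in m variables forces total degree at least E_m·μ^{1+1/m} − O_m(μ).) -/

import Mathlib

/-- `E_m = (m/(m+1))·(m!)^{1/m}`. -/
noncomputable def Em (m : ℕ) : ℝ :=
  ((m : ℝ) / ((m : ℝ) + 1)) * (Nat.factorial m : ℝ) ^ ((1 : ℝ) / (m : ℝ))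

open Finset in
/-- A finite set contains at most `(D + m).choose m` multi-indices of degree at most `D`. -/
theorem card_filter_degree_le_choose (m D : ℕ) (S : Finset (Fin m → ℕ)) :
    #{α ∈ S | ∑ i, α i ≤ D} ≤ (D + m).choose m := by
  classical
  have h_card : Fintype.card (Sym (Fin (m + 1)) D) = (D + m).choose m := by
    rw [Sym.card_sym_eq_choose, Fintype.card_fin, show m + 1 + D - 1 = D + m by omega,
      Nat.choose_symm_add]
  let slack (α : {α // α ∈ S.filter fun α ↦ ∑ i, α i ≤ D}) :
      {P : Fin (m + 1) → ℕ // ∑ i, P i = D} :=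
    ⟨Fin.cons (D - ∑ i, α.1 i) α.1, by
      have := (mem_filter.1 α.2).2
      rw [Fin.sum_univ_succ]
      simp only [Fin.cons_zero, Fin.cons_succ]
      omega⟩
  have h_inj : Function.Injective slack := fun α β h ↦
    Subtype.ext <| by
    have h_cons : (Fin.cons _ α.1 : Fin (m + 1) → ℕ) = Fin.cons _ β.1 := congrArg Subtype.val h
    exact (Fin.cons_injective2 h_cons).2
  rw [← h_card, ← Fintype.card_coe]
  exact Fintype.card_le_of_injective _
    ((Sym.equivNatSumOfFintype (Fin (m + 1)) D).symm.injective.comp h_inj)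

open Finset in
theorem sum_sub_degree_le_choose (m D : ℕ) (S : Finset (Fin m → ℕ)) :
    ∑ α ∈ S, (D - ∑ i, α i) ≤ (D + m).choose (m + 1) := by
  induction D with
  | zero => simp
  | succ D ih =>
    have h_split : ∑ α ∈ S, (D + 1 - ∑ i, α i) =
        ∑ α ∈ S, (D - ∑ i, α i) + #{α ∈ S | ∑ i, α i ≤ D} := by
      rw [card_filter, ← sum_add_distrib]
      refine sum_congr rfl fun α _ ↦ ?_
      split_ifs <;> omega
    have h_card := card_filter_degree_le_choose m D S
    rw [h_split, Nat.add_right_comm D 1 m, Nat.choose_succ_succ']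
    omega

/-- The total degree of `S` is bounded below by comparing every degree with a threshold `D`. -/
theorem mul_card_sub_le_sum_degree (m D : ℕ) (S : Finset (Fin m → ℕ)) :
    (D : ℝ) * S.card - ((D : ℝ) + m) ^ (m + 1) / (m + 1).factorial
      ≤ ∑ α ∈ S, ((∑ i, α i : ℕ) : ℝ) := by
  have h_nat : D * S.card ≤ ∑ α ∈ S, ∑ i, α i + (D + m).choose (m + 1) := by
    calc D * S.card = ∑ _α ∈ S, D := by rw [Finset.sum_const, smul_eq_mul, mul_comm]
      _ ≤ ∑ α ∈ S, (∑ i, α i + (D - ∑ i, α i)) := Finset.sum_le_sum fun α _ ↦ by omega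
      _ ≤ _ := by
        rw [Finset.sum_add_distrib]
        exact Nat.add_le_add_left (sum_sub_degree_le_choose m D S) _
  have h_real : (D : ℝ) * S.card ≤
      ∑ α ∈ S, ((∑ i, α i : ℕ) : ℝ) + ((D + m).choose (m + 1) : ℕ) := by
    exact_mod_cast h_nat
  have h_choose := Nat.choose_le_pow_div (α := ℝ) (m + 1) (D + m)
  push_cast at h_choose h_real ⊢
  linarith

/-- Combinatorial degree count underlying the exponent `E_m·μ^{1+1/m}` in the interpolation
determinant estimate: any finite set `S` of multi-indices in `m` variables has total degree
`∑_{α∈S} |α| ≥ E_m·(#S)^{1+1/m} − c·(#S)`. -/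
theorem stmt18 (m : ℕ) (hm : 1 ≤ m) :
    ∃ c : ℝ, 0 < c ∧
      ∀ S : Finset (Fin m → ℕ),
        Em m * (S.card : ℝ) ^ (1 + 1 / (m : ℝ)) - c * (S.card : ℝ)
          ≤ ∑ α ∈ S, ((∑ i, α i : ℕ) : ℝ) := by
  refine ⟨m + 1, by positivity, fun S ↦ ?_⟩
  have hm₀ : (0 : ℝ) < m := by exact_mod_cast hm
  set n : ℝ := (S.card : ℝ) with hn
  have hn₀ : 0 ≤ n := by positivity
  set T : ℝ := (m.factorial * n) ^ (1 / (m : ℝ)) with hT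
  have hT₀ : 0 ≤ T := by positivity
  have hT_pow : T ^ m = m.factorial * n := by
    rw [hT, one_div]
    exact Real.rpow_inv_natCast_pow (by positivity) (by omega)
  have h_main : Em m * n ^ (1 + 1 / (m : ℝ)) = m / (m + 1) * (T * n) := by
    rw [Em, hT, Real.mul_rpow (by positivity) hn₀,
      Real.rpow_add_of_nonneg hn₀ zero_le_one (by positivity), Real.rpow_one]
    ring
  rw [h_main]
  rcases lt_or_ge T m with h_lt | h_ge
  · have h_sum : (0 : ℝ) ≤ ∑ α ∈ S, ((∑ i, α i : ℕ) : ℝ) := by positivity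
    have h_frac : (m : ℝ) / (m + 1) ≤ 1 := by
      rw [div_le_one (by positivity)]
      linarith
    have h_le : (m : ℝ) / (m + 1) * (T * n) ≤ 1 * ((m + 1) * n) := by
      gcongr
      linarith
    linarith
  · set D := ⌊T - m⌋₊
    have hD_le : (D : ℝ) ≤ T - m := Nat.floor_le (by linarith)
    have hD_gt : T - m < D + 1 := Nat.lt_floor_add_one _
    have h_pow : ((D : ℝ) + m) ^ (m + 1) / (m + 1).factorial ≤ T * n / (m + 1) := by
      calc ((D : ℝ) + m) ^ (m + 1) / (m + 1).factorial
          ≤ T ^ (m + 1) / (m + 1).factorial := by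
            gcongr
            linarith
        _ = T * n / (m + 1) := by
            rw [pow_succ, hT_pow, Nat.factorial_succ]
            push_cast
            field_simp
    have h_mul : (T - m - 1) * n ≤ D * n := by
      gcongr
      linarith
    have h_frac : (m : ℝ) / (m + 1) * (T * n) = T * n - T * n / (m + 1) := by
      field_simp
      ring
    have h_bound := mul_card_sub_le_sum_degree m D S
    rw [← hn] at h_bound
    linarith
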